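/- arXiv:2212.07830 — 2 statements merged into one kernel-verified Lean document; each statement's English description precedes it below -/
import Mathlib

section
/- Let G be a discrete group and (X,G) a transitive G-system. If (X,G) is weakly disjoint with all minimal G-systems, then (X,G) is weakly disjoint with every transitive G-system whose minimal points are dense. -/
/-- A `G`-system: a compact metrizable space with a continuous action of the
(discrete) group `G` by homeomorphisms. -/
structure GSys (G : Type) [Group G] : Type 1 where
  carrier : Type
  [ts : TopologicalSpace carrier]
  [cs : CompactSpace carrier]
  [ms : TopologicalSpace.MetrizableSpace carrier]
  [ma : MulAction G carrier]
  [cts : ContinuousConstSMul G carrier]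

attribute [instance] GSys.ts GSys.cs GSys.ms GSys.ma GSys.cts

/-- A `G`-system is minimal if every orbit is dense. -/
def GSys.Minimal {G : Type} [Group G] (Y : GSys G) : Prop :=
  ∀ y : Y.carrier, Dense (MulAction.orbit G y)

/-- A joining of the `G`-systems `X` and `Y`: a nonempty closed subset of `X × Y`,
invariant under the diagonal `G`-action, projecting onto both coordinates. -/
def IsJoining (G : Type) [Group G] {X Y : Type} [TopologicalSpace X] [TopologicalSpace Y]
    [MulAction G X] [MulAction G Y] (J : Set (X × Y)) : Prop :=
  J.Nonempty ∧ IsClosed J ∧ (∀ g : G, ∀ p ∈ J, (g • p.1, g • p.2) ∈ J) ∧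
    Prod.fst '' J = Set.univ ∧ Prod.snd '' J = Set.univ

/-- Two `G`-systems are disjoint if their only joining is `X × Y`. -/
def DisjointSys (G : Type) [Group G] (X Y : Type) [TopologicalSpace X] [TopologicalSpace Y]
    [MulAction G X] [MulAction G Y] : Prop :=
  ∀ J : Set (X × Y), IsJoining G J → J = Set.univ

/-- A `G`-space is (topologically) transitive: for all nonempty open `U, V` there is
`g ∈ G` with `gU ∩ V ≠ ∅`. -/
def TransSys (G : Type) [Group G] (X : Type) [TopologicalSpace X] [MulAction G X] : Prop :=
  ∀ U V : Set X, IsOpen U → IsOpen V → U.Nonempty → V.Nonempty →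
    ∃ g : G, ((g • ·) '' U ∩ V).Nonempty

/-- Two `G`-systems are weakly disjoint if the product system `(X × Y, G)` (diagonal
action) is transitive. -/
def WeaklyDisjoint (G : Type) [Group G] (X Y : Type) [TopologicalSpace X] [TopologicalSpace Y]
    [MulAction G X] [MulAction G Y] : Prop :=
  TransSys G (X × Y)

/-- A point `x` of a `G`-space is a minimal point if its orbit closure is a minimal
system, i.e. every point of the orbit closure of `x` has the same orbit closure. -/
def IsMinimalPoint (G : Type) [Group G] {X : Type*} [TopologicalSpace X] [MulAction G X]
    (x : X) : Prop :=
  ∀ y ∈ closure (MulAction.orbit G x),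
    closure (MulAction.orbit G y) = closure (MulAction.orbit G x)

/-- The orbit closure of a point as an invariant subset. -/
def orbitClosureSub (G : Type) [Group G] {Y : Type} [TopologicalSpace Y] [MulAction G Y]
    [ContinuousConstSMul G Y] (y : Y) : SubMulAction G Y where
  carrier := closure (MulAction.orbit G y)
  smul_mem' := by
    intro g z hz
    refine map_mem_closure (continuous_const_smul g) hz ?_
    rintro _ ⟨k, rfl⟩
    exact ⟨g * k, mul_smul g k y⟩

/-- The orbit closure of a point as a system. -/
def orbitClosureSys {G : Type} [Group G] (Y : GSys G) (y : Y.carrier) : GSys G :=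
  haveI : CompactSpace (orbitClosureSub G y) :=
    isCompact_iff_compactSpace.mp (isClosed_closure (s := MulAction.orbit G y)).isCompact
  haveI : ContinuousConstSMul G (orbitClosureSub G y) :=
    ⟨fun g => ((continuous_const_smul g).comp continuous_subtype_val).subtype_mk _⟩
  { carrier := orbitClosureSub G y
    ms := Topology.IsEmbedding.subtypeVal.metrizableSpace }

theorem orbitClosureSys_minimal {G : Type} [Group G] (Y : GSys G) (y : Y.carrier)
    (hy : IsMinimalPoint G y) : (orbitClosureSys Y y).Minimal := by
  change ∀ z : orbitClosureSub G y, Dense (MulAction.orbit G z)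
  intro z w
  rw [closure_subtype]
  have hw : (w : Y.carrier) ∈ closure (MulAction.orbit G (z : Y.carrier)) := by
    rw [hy z z.2]; exact w.2
  refine closure_mono ?_ hw
  rintro _ ⟨k, rfl⟩
  exact ⟨k • z, ⟨k, rfl⟩, rfl⟩

/-- If a transitive `G`-system `(X,G)` is weakly disjoint with all minimal `G`-systems,
then it is weakly disjoint with every transitive `G`-system with dense minimal points. -/
theorem stmt13 (G : Type) [Group G]
    (X : Type) [TopologicalSpace X] [CompactSpace X] [TopologicalSpace.MetrizableSpace X]
    [MulAction G X] [ContinuousConstSMul G X]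
    (htrans : TransSys G X)
    (h : ∀ Y : GSys G, Y.Minimal → WeaklyDisjoint G X Y.carrier) :
    ∀ Y : GSys G, TransSys G Y.carrier → Dense {y : Y.carrier | IsMinimalPoint G y} →
      WeaklyDisjoint G X Y.carrier := by
  intro Y hY hd A B hA hB hAn hBn
  obtain ⟨⟨a1, a2⟩, ha⟩ := hAn
  obtain ⟨⟨b1, b2⟩, hb⟩ := hBn
  obtain ⟨U, V, hU, hV, haU, haV, hUV⟩ := isOpen_prod_iff.mp hA a1 a2 ha
  obtain ⟨U', V', hU', hV', hbU, hbV, hUV'⟩ := isOpen_prod_iff.mp hB b1 b2 hb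
  obtain ⟨g, _, ⟨v, hv, rfl⟩, hgv⟩ := hY V V' hV hV' ⟨_, haV⟩ ⟨_, hbV⟩
  have hW : IsOpen (V ∩ (g • ·) ⁻¹' V') := hV.inter (hV'.preimage (continuous_const_smul g))
  obtain ⟨y, hyW, hy⟩ := hd.inter_open_nonempty _ hW ⟨v, hv, hgv⟩
  have key : TransSys G (X × orbitClosureSub G y) :=
    h (orbitClosureSys Y y) (orbitClosureSys_minimal Y y hy)
  have hW' : IsOpen ((Subtype.val : orbitClosureSub G y → Y.carrier) ⁻¹' (V ∩ (g • ·) ⁻¹' V')) :=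
    hW.preimage continuous_subtype_val
  have hym : y ∈ orbitClosureSub G y := subset_closure (MulAction.mem_orbit_self y)
  obtain ⟨k, _, ⟨⟨p, q⟩, ⟨hp, hq⟩, rfl⟩, hp', hq'⟩ := key
    (U ×ˢ (Subtype.val ⁻¹' (V ∩ (g • ·) ⁻¹' V')))
    (((g • ·) ⁻¹' U') ×ˢ (Subtype.val ⁻¹' (V ∩ (g • ·) ⁻¹' V')))
    (hU.prod hW') ((hU'.preimage (continuous_const_smul g)).prod hW')
    ⟨(a1, ⟨y, hym⟩), haU, hyW⟩
    ⟨(g⁻¹ • b1, ⟨y, hym⟩), by simpa using hbU, hyW⟩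
  refine ⟨g * k, _, ⟨(p, q.1), hUV ⟨hp, hq.1⟩, rfl⟩, hUV' ⟨?_, ?_⟩⟩
  · change (g * k) • p ∈ U'
    rw [mul_smul]; exact hp'
  · change (g * k) • q.1 ∈ V'
    rw [mul_smul]; exact hq'.2
end

section
/- Let G be a countable discrete group, (X,G) a transitive G-system, and x a transitive point of X. Then (X,G) is disjoint with all minimal G-systems if and only if N_G(x,U) ∩ A ≠ ∅ for every open neighborhood U of x and every m-set A of G. -/
/-- `A ⊆ G` is an m-set: there are a minimal `G`-system `(Y,G)`, a point `y ∈ Y` and a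
nonempty open set `V ⊆ Y` such that `N_G(y,V) = {g : g • y ∈ V} ⊆ A`. -/
def IsMSet (G : Type) [Group G] (A : Set G) : Prop :=
  ∃ Y : GSys G, Y.Minimal ∧ ∃ (y : Y.carrier) (V : Set Y.carrier),
    IsOpen V ∧ V.Nonempty ∧ {g : G | g • y ∈ V} ⊆ A

/-- Let `G` be a countable discrete group, `(X,G)` a transitive `G`-system and `x` a
transitive point. Then `(X,G)` is disjoint with all minimal `G`-systems iff
`N_G(x,U) ∩ A ≠ ∅` for every open neighborhood `U` of `x` and every m-set `A` of `G`. -/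
theorem stmt17 (G : Type) [Group G] [Countable G]
    (X : Type) [TopologicalSpace X] [CompactSpace X] [TopologicalSpace.MetrizableSpace X]
    [MulAction G X] [ContinuousConstSMul G X]
    (x : X) (hx : Dense (MulAction.orbit G x)) :
    (∀ Y : GSys G, Y.Minimal → DisjointSys G X Y.carrier) ↔
      ∀ U : Set X, IsOpen U → x ∈ U → ∀ A : Set G, IsMSet G A →
        ({g : G | g • x ∈ U} ∩ A).Nonempty := by
  constructor
  · intro h U hU hxU A hA
    obtain ⟨Y, hY, y, V, hV, ⟨v, hv⟩, hVA⟩ := hA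
    have key := h Y hY (closure (Set.range fun g : G => (g • x, g • y))) ?_
    · have hm : (x, v) ∈ closure (Set.range fun g : G => (g • x, g • y)) := by
        rw [key]; trivial
      obtain ⟨p, ⟨hp1, hp2⟩, ⟨g, rfl⟩⟩ :=
        mem_closure_iff.1 hm (U ×ˢ V) (hU.prod hV) ⟨hxU, hv⟩
      exact ⟨g, hp1, hVA hp2⟩
    · have hc : IsCompact (closure (Set.range fun g : G => (g • x, g • y))) :=
        isClosed_closure.isCompact
      refine ⟨⟨_, subset_closure ⟨1, rfl⟩⟩, isClosed_closure, ?_, ?_, ?_⟩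
      · intro g p hp
        have hcont : Continuous fun p : X × Y.carrier => (g • p.1, g • p.2) :=
          (continuous_fst.const_smul g).prodMk (continuous_snd.const_smul g)
        refine map_mem_closure (f := fun p : X × Y.carrier => (g • p.1, g • p.2)) hcont hp ?_
        rintro _ ⟨k, rfl⟩
        exact ⟨g * k, by simp [mul_smul]⟩
      · have hcl := (hc.image continuous_fst).isClosed
        rw [← hcl.closure_eq]
        refine (hx.mono ?_).closure_eq
        rintro _ ⟨g, rfl⟩
        exact ⟨_, subset_closure ⟨g, rfl⟩, rfl⟩
      · have hcl := (hc.image continuous_snd).isClosed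
        rw [← hcl.closure_eq]
        refine ((hY y).mono ?_).closure_eq
        rintro _ ⟨g, rfl⟩
        exact ⟨_, subset_closure ⟨g, rfl⟩, rfl⟩
  · rintro h Y hY J ⟨-, hJc, hJi, hJ1, -⟩
    obtain ⟨⟨x', y⟩, hy, hxx⟩ : x ∈ Prod.fst '' J := by rw [hJ1]; trivial
    obtain rfl : x' = x := hxx
    have h1 : ∀ z : Y.carrier, (x', z) ∈ J := by
      intro z
      rw [← hJc.closure_eq, mem_closure_iff]
      intro O hO hz
      obtain ⟨U, V, hU, hV, hxU, hzV, hUV⟩ := isOpen_prod_iff.1 hO x' z hz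
      obtain ⟨g, hg1, hg2⟩ := h U hU hxU {g : G | g • y ∈ V}
        ⟨Y, hY, y, V, hV, ⟨z, hzV⟩, subset_rfl⟩
      exact ⟨(g • x', g • y), hUV ⟨hg1, hg2⟩, hJi g _ hy⟩
    rw [Set.eq_univ_iff_forall]
    rintro ⟨w, z⟩
    have hcl : IsClosed {w : X | (w, z) ∈ J} :=
      hJc.preimage (continuous_id.prodMk continuous_const)
    have hsub : MulAction.orbit G x' ⊆ {w : X | (w, z) ∈ J} := by
      rintro _ ⟨g, rfl⟩
      have := hJi g _ (h1 (g⁻¹ • z))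
      simpa using this
    exact hcl.closure_subset_iff.2 hsub (hx w)
end
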